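/- Let d ≥ 2, m ≥ 2 and k ≥ 1 be integers with m ≤ d + k and d ≥ 2k, let p_1,…,p_m be nonnegative integers, not all zero, and let n satisfy binom(n+d,d) = Σ_{q=1}^m binom(p_q+d,d). Then the Hermite interpolation scheme is singular: for every choice of pairwise distinct points X_1,…,X_m ∈ ℝ^d there exists a nonzero polynomial f of total degree at most n such that ∂^α f(X_q) = 0 for all 1 ≤ q ≤ m and all multi-indices α with |α| ≤ p_q. -/

import Mathlib

open MvPolynomial

/-- The iterated partial derivative `∂^α` as a linear endomorphism of `ℝ[x_1,…,x_d]`. -/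
noncomputable def pderivPow {d : ℕ} (α : Fin d → ℕ) :
    Module.End ℝ (MvPolynomial (Fin d) ℝ) :=
  ((List.finRange d).map fun i => ((MvPolynomial.pderiv i).toLinearMap ^ α i)).prod

/-- The Hermite ideal `I(X,p)`, as a set: all polynomials whose partial derivatives of
order up to `p q` all vanish at `X q`, for every `q`. -/
def hermiteSet {d m : ℕ} (X : Fin m → (Fin d → ℝ)) (p : Fin m → ℕ) :
    Set (MvPolynomial (Fin d) ℝ) :=
  {f | ∀ q, ∀ α : Fin d → ℕ, (∑ i, α i) ≤ p q → MvPolynomial.eval (X q) (pderivPow α f) = 0}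


open Finset in
theorem card_degree_le (d n : ℕ) :
    #((range (n + 1)).biUnion fun j => (univ : Finset (Fin d)).finsuppAntidiag j) =
      (n + d).choose d := by
  rw [card_biUnion, ← Nat.sum_range_multichoose]
  · simp [card_finsuppAntidiag_nat_eq_multichoose]
  · intro i _ j _ hij
    rw [Function.onFun, Finset.disjoint_left]
    intro a ha hb
    simp only [mem_finsuppAntidiag] at ha hb
    exact hij (ha.1.symm.trans hb.1)

open Finset in
theorem mem_degree_le {d n : ℕ} {α : Fin d →₀ ℕ} :
    α ∈ ((range (n + 1)).biUnion fun j => (univ : Finset (Fin d)).finsuppAntidiag j) ↔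
      α.degree ≤ n := by
  simp [Finsupp.degree_eq_sum]

theorem finrank_restrictTotalDegree_fin (d n : ℕ) :
    Module.finrank ℝ (restrictTotalDegree (Fin d) ℝ n) = (n + d).choose d := by
  rw [← card_degree_le, restrictTotalDegree]
  rw [Module.finrank_eq_nat_card_basis (basisRestrictSupport ℝ _)]
  rw [← Nat.card_eq_finsetCard]
  refine Nat.card_congr (Equiv.subtypeEquivRight fun α => ?_)
  rw [mem_degree_le]
  exact Iff.rfl

theorem exists_ne_zero_of_card_lt {ι : Type*} [Fintype ι] {d n : ℕ}
    (L : ι → MvPolynomial (Fin d) ℝ →ₗ[ℝ] ℝ) (h : Fintype.card ι < (n + d).choose d) :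
    ∃ f : MvPolynomial (Fin d) ℝ, f ≠ 0 ∧ f.totalDegree ≤ n ∧ ∀ i, L i f = 0 := by
  have hk := LinearMap.ker_ne_bot_of_finrank_lt
    (f := (LinearMap.pi L).domRestrict (restrictTotalDegree (Fin d) ℝ n))
    (by rwa [finrank_restrictTotalDegree_fin, Module.finrank_fintype_fun_eq_card])
  obtain ⟨f, hf, hf0⟩ := Submodule.exists_mem_ne_zero_of_ne_bot hk
  refine ⟨f, by simpa using hf0, (mem_restrictTotalDegree _ _ _).1 f.2, fun i => ?_⟩
  exact congrFun (LinearMap.mem_ker.1 hf) i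

/-- The translation `f ↦ f(x + ·)`. -/
noncomputable def shift {d : ℕ} (x : Fin d → ℝ) :
    MvPolynomial (Fin d) ℝ →ₐ[ℝ] MvPolynomial (Fin d) ℝ :=
  aeval fun i => X i + C (x i)

theorem shift_neg_shift {d : ℕ} (x : Fin d → ℝ) (f : MvPolynomial (Fin d) ℝ) :
    shift (-x) (shift x f) = f := by
  rw [← AlgHom.comp_apply]
  conv_rhs => rw [← AlgHom.id_apply (R := ℝ) f]
  congr 1
  ext1 i
  simp [shift, add_assoc]

theorem mem_ker_eval_pow_of_shift {d r : ℕ} {x : Fin d → ℝ} {f : MvPolynomial (Fin d) ℝ}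
    (h : shift x f ∈ idealOfVars (Fin d) ℝ ^ r) : f ∈ RingHom.ker (eval x) ^ r := by
  have h1 := Ideal.mem_map_of_mem (shift (-x)) h
  rw [shift_neg_shift, Ideal.map_pow] at h1
  refine Ideal.pow_right_mono ?_ r h1
  rw [Ideal.map_span, Ideal.span_le]
  rintro _ ⟨_, ⟨i, rfl⟩, rfl⟩
  simp [shift, RingHom.mem_ker]

theorem Derivation.mem_pow_of_mem_pow_succ {R A : Type*} [CommRing R] [CommRing A] [Algebra R A]
    (D : Derivation R A A) (I : Ideal A) (r : ℕ) {f : A} (hf : f ∈ I ^ (r + 1)) :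
    D f ∈ I ^ r := by
  induction r generalizing f with
  | zero => simp
  | succ r ih =>
    rw [pow_succ] at hf
    refine Submodule.mul_induction_on hf (fun a ha b hb => ?_) (fun a b ha hb => ?_)
    · rw [Derivation.leibniz, smul_eq_mul, smul_eq_mul]
      refine add_mem (Ideal.mul_mem_right _ _ ha) ?_
      rw [pow_succ, mul_comm b]
      exact Ideal.mul_mem_mul (ih ha) hb
    · rw [map_add]; exact add_mem ha hb

theorem Derivation.pow_apply_mem {R A : Type*} [CommRing R] [CommRing A] [Algebra R A]
    (D : Derivation R A A) (I : Ideal A) (r s : ℕ) {f : A} (hf : f ∈ I ^ (r + s)) :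
    (D.toLinearMap ^ s) f ∈ I ^ r := by
  induction s generalizing f with
  | zero => simpa using hf
  | succ s ih =>
    rw [pow_succ]
    exact ih (D.mem_pow_of_mem_pow_succ I _ hf)

theorem mem_of_pderivPow_list {d : ℕ} (I : Ideal (MvPolynomial (Fin d) ℝ)) (α : Fin d → ℕ)
    (l : List (Fin d)) (r : ℕ) {f : MvPolynomial (Fin d) ℝ}
    (hf : f ∈ I ^ (r + (l.map α).sum)) :
    (l.map fun i => (pderiv i).toLinearMap ^ α i).prod f ∈ I ^ r := by
  induction l generalizing r with
  | nil => simpa using hf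
  | cons i l ih =>
    rw [List.map_cons, List.sum_cons, ← add_assoc] at hf
    rw [List.map_cons, List.prod_cons]
    exact Derivation.pow_apply_mem _ I r _ (ih _ hf)

theorem mem_hermiteSet_of_mem_pow {d m : ℕ} {X : Fin m → (Fin d → ℝ)} {p : Fin m → ℕ}
    {f : MvPolynomial (Fin d) ℝ} (h : ∀ q, f ∈ RingHom.ker (eval (X q)) ^ (p q + 1)) :
    f ∈ hermiteSet X p := by
  intro q α hα
  have hs : ((List.finRange d).map α).sum = ∑ i, α i := by
    rw [← List.ofFn_eq_map, List.sum_ofFn]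
  have := mem_of_pderivPow_list (RingHom.ker (eval (X q))) α (List.finRange d) 1
    (f := f) (Ideal.pow_le_pow_right (by omega) (h q))
  rw [pow_one] at this
  exact this

/-- Any `d` points lie on a hyperplane. -/
theorem exists_hyperplane {d : ℕ} {ι : Type*} (S : Finset ι) (hS : S.card ≤ d)
    (X : ι → Fin d → ℝ) :
    ∃ f : MvPolynomial (Fin d) ℝ, f ≠ 0 ∧ f.totalDegree ≤ 1 ∧
      ∀ q ∈ S, f ∈ RingHom.ker (eval (X q)) := by
  obtain ⟨f, h0, h1, h2⟩ := exists_ne_zero_of_card_lt (ι := S) (n := 1)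
    (fun q => (aeval (X q)).toLinearMap) (by
      rw [Fintype.card_coe, add_comm 1 d, Nat.choose_succ_self_right]; omega)
  exact ⟨f, h0, h1, fun q hq => h2 ⟨q, hq⟩⟩

open Finset in
theorem exists_balanced_cover {m d n : ℕ} (a : Fin m → ℕ) (ha : ∀ q, a q ≤ n)
    (hsum : ∑ q, a q ≤ d * n) :
    ∃ S : ℕ → Finset (Fin m), (∀ s, #(S s) ≤ d) ∧ ∀ q, a q ≤ #{s ∈ range n | q ∈ S s} := by
  classical
  let e : (Σ q, Fin (a q)) → ℕ := fun x => finSigmaFinEquiv x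
  have he : Function.Injective e := Fin.val_injective.comp finSigmaFinEquiv.injective
  have hed (x) : e x / n < d := by
    rw [Nat.div_lt_iff_lt_mul ((x.2.pos).trans_le (ha _))]
    exact (finSigmaFinEquiv x).2.trans_le hsum
  refine ⟨fun s => {q | ∃ t : Fin (a q), e ⟨q, t⟩ % n = s}, fun s => ?_, fun q => ?_⟩
  · have hmem : ∀ q ∈ ({q | ∃ t : Fin (a q), e ⟨q, t⟩ % n = s} : Finset (Fin m)),
        ∃ t : Fin (a q), e ⟨q, t⟩ % n = s := fun q hq => by simpa using hq
    choose t ht using hmem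
    rw [← card_range d, ← card_attach]
    refine card_le_card_of_injOn (fun q => e ⟨q.1, t q.1 q.2⟩ / n)
      (fun q _ => by simpa using hed _) fun q _ r _ h => ?_
    have : e ⟨q.1, t q.1 q.2⟩ = e ⟨r.1, t r.1 r.2⟩ := by
      rw [← Nat.div_add_mod (e ⟨q.1, t q.1 q.2⟩) n, ← Nat.div_add_mod (e ⟨r.1, t r.1 r.2⟩) n,
        ht, ht]
      exact congrArg (n * · + s) h
    exact Subtype.ext (congrArg Sigma.fst (he this))
  · rw [← Fintype.card_fin (a q), ← card_univ]
    refine card_le_card_of_injOn (fun t => e ⟨q, t⟩ % n) (fun t _ => ?_) fun t _ t' _ h => ?_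
    · simpa using Nat.mod_lt _ (t.pos.trans_le (ha q))
    · have h' : e ⟨q, t⟩ ≡ e ⟨q, t'⟩ [MOD n] := h
      simp only [e, finSigmaFinEquiv_apply] at h'
      exact Fin.ext ((Nat.ModEq.add_left_cancel' _ h').eq_of_lt_of_lt
        (t.2.trans_le (ha q)) (t'.2.trans_le (ha q)))

/-- If the orders are small enough, a product of `n` hyperplanes vanishes to the right orders. -/
theorem exists_prod_hyperplanes {d m n : ℕ} (X : Fin m → Fin d → ℝ) (a : Fin m → ℕ)
    (ha : ∀ q, a q ≤ n) (hsum : ∑ q, a q ≤ d * n) :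
    ∃ f : MvPolynomial (Fin d) ℝ, f ≠ 0 ∧ f.totalDegree ≤ n ∧
      ∀ q, f ∈ RingHom.ker (eval (X q)) ^ a q := by
  classical
  obtain ⟨S, hS, hcov⟩ := exists_balanced_cover a ha hsum
  choose l hl0 hl1 hl using fun s => exists_hyperplane (S s) (hS s) X
  refine ⟨∏ s ∈ Finset.range n, l s, Finset.prod_ne_zero_iff.2 fun s _ => hl0 s, ?_, fun q => ?_⟩
  · refine (totalDegree_finsetProd _ _).trans ((Finset.sum_le_sum fun s _ => hl1 s).trans ?_)
    simp
  · rw [← Finset.prod_filter_mul_prod_filter_not _ (fun s => q ∈ S s)]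
    refine Ideal.mul_mem_right _ _ (Ideal.pow_le_pow_right (hcov q) ?_)
    rw [← Finset.prod_const]
    exact Ideal.prod_mem_prod fun s hs => hl s q (Finset.mem_filter.1 hs).2

/-- The restriction of a polynomial to the line `t ↦ x + t • v`. -/
noncomputable def lineRestrict {d : ℕ} (x v : Fin d → ℝ) :
    MvPolynomial (Fin d) ℝ →ₐ[ℝ] Polynomial ℝ :=
  aeval fun i => Polynomial.C (x i) + Polynomial.C (v i) * Polynomial.X

theorem eval_lineRestrict {d : ℕ} (x v : Fin d → ℝ) (t : ℝ) (f : MvPolynomial (Fin d) ℝ) :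
    (lineRestrict x v f).eval t = eval (x + t • v) f := by
  rw [← Polynomial.coe_aeval_eq_eval, ← coe_aeval_eq_eval]
  change ((Polynomial.aeval t).comp (lineRestrict x v)) f = aeval (x + t • v) f
  congr 1
  ext i
  simp [lineRestrict, mul_comm t]

theorem dvd_lineRestrict {d r : ℕ} (x v : Fin d → ℝ) (t : ℝ) {f : MvPolynomial (Fin d) ℝ}
    (hf : f ∈ RingHom.ker (eval (x + t • v)) ^ r) :
    (Polynomial.X - Polynomial.C t) ^ r ∣ lineRestrict x v f := by
  rw [← Ideal.mem_span_singleton, ← Ideal.span_singleton_pow]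
  have h1 := Ideal.mem_map_of_mem (lineRestrict x v) hf
  rw [Ideal.map_pow] at h1
  refine Ideal.pow_right_mono ?_ r h1
  rw [Ideal.map_le_iff_le_comap]
  intro g hg
  rw [Ideal.mem_comap, Ideal.mem_span_singleton, Polynomial.dvd_iff_isRoot, Polynomial.IsRoot,
    eval_lineRestrict]
  exact hg

theorem natDegree_lineRestrict_le {d : ℕ} (x v : Fin d → ℝ) (f : MvPolynomial (Fin d) ℝ) :
    (lineRestrict x v f).natDegree ≤ f.totalDegree := by
  rw [← mul_one f.totalDegree]
  refine aeval_natDegree_le f le_rfl _ fun i => ?_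
  compute_degree

/-- On a line through two nodes the vanishing conditions are redundant when their number exceeds
the degree. -/
theorem eq_zero_of_vanishing_on_line {d n r s : ℕ} (hrs : n < r + s + 1) (x v : Fin d → ℝ)
    (c : Fin d) (hc : v c ≠ 0) (b : ℝ) {f : MvPolynomial (Fin d) ℝ} (hdeg : f.totalDegree ≤ n)
    (hx : f - C b * (X c - C (x c)) ^ s ∈ RingHom.ker (eval x) ^ (s + 1))
    (hy : f ∈ RingHom.ker (eval (x - v)) ^ (r + 1)) : b = 0 := by
  have h0 := dvd_lineRestrict x v 0 (by simpa using hx)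
  have h1 := dvd_lineRestrict x v (-1) (r := r + 1) (f := f) (by simpa [← sub_eq_add_neg] using hy)
  obtain ⟨u, hu⟩ := h0
  have hg : lineRestrict x v f =
      Polynomial.X ^ s * (Polynomial.C (b * v c ^ s) + Polynomial.X * u) := by
    have : lineRestrict x v (C b * (X c - C (x c)) ^ s) =
        Polynomial.X ^ s * Polynomial.C (b * v c ^ s) := by
      simp [lineRestrict, algHom_C, Polynomial.algebraMap_eq, mul_pow]
      ring
    rw [map_sub, this, sub_eq_iff_eq_add] at hu
    rw [hu, Polynomial.C_0]
    ring
  have hz : lineRestrict x v f = 0 := by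
    have hdvd : (Polynomial.X - Polynomial.C (0 : ℝ)) ^ s *
        (Polynomial.X - Polynomial.C (-1)) ^ (r + 1) ∣ lineRestrict x v f := by
      refine IsCoprime.mul_dvd (IsCoprime.pow ?_) ?_ h1
      · exact Polynomial.isCoprime_X_sub_C_of_isUnit_sub (by simp)
      · rw [hg, Polynomial.C_0, sub_zero]; exact dvd_mul_right _ _
    by_contra hne
    have := Polynomial.natDegree_le_of_dvd hdvd hne
    have h2 := natDegree_lineRestrict_le x v f
    rw [Polynomial.natDegree_mul (pow_ne_zero _ (Polynomial.X_sub_C_ne_zero _))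
      (pow_ne_zero _ (Polynomial.X_sub_C_ne_zero _)), Polynomial.natDegree_pow,
      Polynomial.natDegree_pow, Polynomial.natDegree_X_sub_C, Polynomial.natDegree_X_sub_C] at this
    omega
  rw [hz, zero_eq_mul, or_iff_right (pow_ne_zero _ Polynomial.X_ne_zero)] at hg
  have := congrArg (Polynomial.eval 0) hg
  simpa [hc] using this

open Finset in
/-- If two orders sum to at least `n`, the interpolation conditions are linearly dependent. -/
theorem exists_of_le_add {d m n : ℕ} (p : Fin m → ℕ)
    (hdim : Nat.choose (n + d) d = ∑ q, Nat.choose (p q + d) d)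
    (Y : Fin m → Fin d → ℝ) {i j : Fin m} (hij : Y i ≠ Y j) (hn : n ≤ p i + p j) :
    ∃ f : MvPolynomial (Fin d) ℝ, f ≠ 0 ∧ f.totalDegree ≤ n ∧
      ∀ q, f ∈ RingHom.ker (eval (Y q)) ^ (p q + 1) := by
  classical
  obtain ⟨c, hc⟩ := Function.ne_iff.1 hij.symm
  let T : Finset (Σ _ : Fin m, Fin d →₀ ℕ) := univ.sigma fun q =>
    (range (p q + 1)).biUnion fun k => (univ : Finset (Fin d)).finsuppAntidiag k
  have hT (q α) : (⟨q, α⟩ : Σ _ : Fin m, Fin d →₀ ℕ) ∈ T ↔ α.degree ≤ p q := by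
    rw [mem_sigma, mem_degree_le]
    simp
  have hTc : #T = (n + d).choose d := by
    rw [card_sigma, hdim]
    exact sum_congr rfl fun q _ => card_degree_le _ _
  let β : Fin d →₀ ℕ := Finsupp.single c (p j)
  have hβ : (⟨j, β⟩ : Σ _ : Fin m, Fin d →₀ ℕ) ∈ T := by simp [hT, β]
  obtain ⟨f, hf0, hfn, hf⟩ := exists_ne_zero_of_card_lt (n := n) (ι := T.erase ⟨j, β⟩)
    (fun x => lcoeff ℝ x.1.2 ∘ₗ (shift (Y x.1.1)).toLinearMap)
    (by rw [Fintype.card_coe, ← hTc]; exact card_erase_lt_of_mem hβ)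
  have hcoeff (q) (α : Fin d →₀ ℕ) (hα : α.degree ≤ p q)
      (hne : (⟨q, α⟩ : Σ _ : Fin m, Fin d →₀ ℕ) ≠ ⟨j, β⟩) : coeff α (shift (Y q) f) = 0 :=
    hf ⟨⟨q, α⟩, mem_erase.2 ⟨hne, (hT q α).2 hα⟩⟩
  have hother (q) (hq : q ≠ j) : f ∈ RingHom.ker (eval (Y q)) ^ (p q + 1) := by
    refine mem_ker_eval_pow_of_shift ((mem_pow_idealOfVars_iff' _ _).2 fun α hα => ?_)
    exact hcoeff q α (Nat.lt_succ_iff.1 hα) fun h => hq (congrArg Sigma.fst h)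
  let b := coeff β (shift (Y j) f)
  have hj : f - C b * (X c - C (Y j c)) ^ p j ∈ RingHom.ker (eval (Y j)) ^ (p j + 1) := by
    refine mem_ker_eval_pow_of_shift ((mem_pow_idealOfVars_iff' _ _).2 fun α hα => ?_)
    have hs : shift (Y j) (C b * (X c - C (Y j c)) ^ p j) = monomial β b := by
      rw [← C_mul_X_pow_eq_monomial]
      simp [shift, algHom_C, algebraMap_eq]
    rw [map_sub, hs, coeff_sub, coeff_monomial]
    split_ifs with h
    · rw [← h, sub_self]
    · rw [sub_zero]
      refine hcoeff j α (Nat.lt_succ_iff.1 hα) fun h' => h ?_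
      simpa using h'.symm
  have hb : b = 0 := by
    refine eq_zero_of_vanishing_on_line (r := p i) (by omega) (Y j) (Y j - Y i) c
      (sub_ne_zero.2 hc) b hfn hj ?_
    rw [sub_sub_cancel]
    exact hother i fun h => hij (congrArg Y h)
  refine ⟨f, hf0, hfn, fun q => ?_⟩
  by_cases hq : q = j
  · subst hq
    simpa [hb] using hj
  · exact hother q hq

theorem sum_succ_le_mul {d m k n : ℕ} (hm : 2 ≤ m) (hmk : m ≤ d + k)
    (hd2k : 2 * k ≤ d) {p : Fin m → ℕ} (hp : ∃ q, p q ≠ 0)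
    (hpair : ∀ i j, i ≠ j → p i + p j < n) : ∑ q, (p q + 1) ≤ d * n := by
  obtain ⟨m, rfl⟩ := Nat.exists_eq_add_of_le' hm
  obtain ⟨i, hi⟩ := hp
  have hn : 2 ≤ n := by
    obtain ⟨j, hj⟩ := exists_ne i
    have := hpair i j hj.symm
    omega
  obtain rfl | hn := hn.eq_or_lt
  · have : ∑ q, p q = p i := Finset.sum_eq_single i (fun j _ hj => by
      have := hpair i j hj.symm
      omega) (by simp)
    obtain ⟨j, hj⟩ := exists_ne i
    have := hpair i j hj.symm
    simp only [Finset.sum_add_distrib, Finset.sum_const, Finset.card_univ, Fintype.card_fin,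
      smul_eq_mul, mul_one]
    omega
  · have h1 : ∑ q, (p q + 1) + ∑ q, (p (finRotate _ q) + 1) ≤ (m + 2) * (n + 1) := by
      rw [← Finset.sum_add_distrib]
      refine (Finset.sum_le_card_nsmul _ _ (n + 1) fun q _ => ?_).trans (by simp)
      have := hpair q (finRotate _ q) (by rw [finRotate_apply]; simp)
      omega
    rw [Equiv.sum_comp (finRotate _) fun q => p q + 1] at h1
    nlinarith

/-- All true Hermite interpolation schemes of type total degree on `m ≤ d + k` nodes with
`d ≥ 2k` are singular. -/
theorem singular_of_d_ge_two_k {d m k n : ℕ} (hd : 2 ≤ d) (hm : 2 ≤ m) (hk : 1 ≤ k)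
    (hmk : m ≤ d + k) (hd2k : 2 * k ≤ d)
    (p : Fin m → ℕ) (hp : ∃ q, p q ≠ 0)
    (hdim : Nat.choose (n + d) d = ∑ q, Nat.choose (p q + d) d)
    (X : Fin m → (Fin d → ℝ)) (hX : Function.Injective X) :
    ∃ f : MvPolynomial (Fin d) ℝ, f ≠ 0 ∧ f.totalDegree ≤ n ∧ f ∈ hermiteSet X p := by
  by_cases h : ∃ i j, i ≠ j ∧ n ≤ p i + p j
  · obtain ⟨i, j, hij, hn⟩ := h
    obtain ⟨f, hf0, hfn, hf⟩ := exists_of_le_add p hdim X (hX.ne hij) hn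
    exact ⟨f, hf0, hfn, mem_hermiteSet_of_mem_pow hf⟩
  · push Not at h
    obtain ⟨f, hf0, hfn, hf⟩ := exists_prod_hyperplanes X (fun q => p q + 1) (fun q => by
        have : Nontrivial (Fin m) := Fin.nontrivial_iff_two_le.2 hm
        obtain ⟨j, hj⟩ := exists_ne q
        have := h q j hj.symm
        omega) (sum_succ_le_mul hm hmk hd2k hp h)
    exact ⟨f, hf0, hfn, mem_hermiteSet_of_mem_pow hf⟩
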